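/- Let α > 0, θ ∈ ℝ, let X be a complex Banach space, (φ̇_n)_{n∈ℤ} a homogeneous dyadic partition of unity, φ̃̇_n = φ̇_{n-1} + φ̇_n + φ̇_{n+1}, and Φ a bounded M^α calculus on X satisfying the Paley–Littlewood convergence property for (φ̇_n). Then there is a constant C > 0 such that: (i) if x ∈ X satisfies Φ(φ̇_n)x = 0 for all but finitely many n ∈ ℤ and y := Σ_{n∈ℤ} Φ( t ↦ t^{θ} φ̇_n(t) ) x (a finite sum; t ↦ t^{θ} φ̇_n(t) ∈ M^α), then ‖y‖ ≤ C Σ_{n∈ℤ} 2^{nθ} ‖Φ(φ̇_n) x‖; (ii) if x, y ∈ X satisfy Φ(φ̇_n) x = Φ( t ↦ t^{-θ} φ̇_n(t) ) y for all n ∈ ℤ (encoding y = A^θ x), then sup_{n∈ℤ} 2^{nθ} ‖Φ(φ̇_n) x‖ ≤ C ‖y‖. (This expresses the continuous embeddings Ḃ^θ_1 ⊂ Ẋ_θ ⊂ Ḃ^θ_∞ between homogeneous Besov-type spaces and the fractional domain space.) -/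

import Mathlib

open MeasureTheory Filter Topology
open scoped ENNReal NNReal

noncomputable section

/-- Iterated difference `Δ_h^M g (x) = ∑_{j=0}^M (-1)^{M-j} (M choose j) g(x + j h)`. -/
def iterDiff (M : ℕ) (h : ℝ) (g : ℝ → ℂ) (x : ℝ) : ℂ :=
  ∑ j ∈ Finset.range (M + 1), (-1 : ℂ) ^ (M - j) * (M.choose j : ℂ) * g (x + j * h)

/-- The Besov `ℬ^β_{∞,∞}` norm (with difference parameter `M`). -/
def besovII (β : ℝ) (M : ℕ) (g : ℝ → ℂ) : ℝ≥0∞ :=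
  (⨆ x : ℝ, (‖g x‖₊ : ℝ≥0∞)) +
    ⨆ (x : ℝ) (h : ℝ) (_ : h ≠ 0),
      ENNReal.ofReal (|h| ^ (-β)) * (‖iterDiff M h g x‖₊ : ℝ≥0∞)

/-- The Besov `ℬ^α_{∞,1}` norm (with difference parameter `M`). -/
def besovI1 (α : ℝ) (M : ℕ) (g : ℝ → ℂ) : ℝ≥0∞ :=
  (⨆ x : ℝ, (‖g x‖₊ : ℝ≥0∞)) +
    ∫⁻ h in Set.Ioo (-1 : ℝ) 1,
      ENNReal.ofReal (|h| ^ (-α - 1)) * ⨆ x : ℝ, (‖iterDiff M h g x‖₊ : ℝ≥0∞)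

/-- The Mihlin class norm `‖f‖_{M^α} = ‖f ∘ exp‖_{ℬ^α_{∞,1}}`. -/
def mihlin (α : ℝ) (M : ℕ) (f : ℝ → ℂ) : ℝ≥0∞ :=
  besovI1 α M fun s => f (Real.exp s)

/-- A homogeneous dyadic partition of unity on `(0,∞)`. -/
structure DyadicPartition where
  φ : ℝ → ℝ
  smooth : ContDiff ℝ (⊤ : ℕ∞) φ
  mem_Icc : ∀ t, φ t ∈ Set.Icc (0 : ℝ) 1
  suppSub : ∀ t, φ t ≠ 0 → t ∈ Set.Icc (1 / 2 : ℝ) 2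
  sum_one : ∀ t : ℝ, 0 < t → HasSum (fun n : ℤ => φ ((2 : ℝ) ^ (-n) * t)) 1

/-- `φ̇_n(t) = φ̇_0(2^{-n} t)`, as a complex-valued function. -/
def DyadicPartition.fn (P : DyadicPartition) (n : ℤ) : ℝ → ℂ :=
  fun t => (P.φ ((2 : ℝ) ^ (-n) * t) : ℂ)

/-- The `M^α_1` norm `∑_{n∈ℤ} ‖f ⬝ φ̇_n‖_{M^α}`. -/
def mihlinOne (α : ℝ) (M : ℕ) (P : DyadicPartition) (f : ℝ → ℂ) : ℝ≥0∞ :=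
  ∑' n : ℤ, mihlin α M fun t => f t * P.fn n t

/-- A bounded `M^α` calculus on a complex Banach space `X`. -/
structure MihlinCalculus (α : ℝ) (M : ℕ) (X : Type*) [NormedAddCommGroup X]
    [NormedSpace ℂ X] where
  Φ : (ℝ → ℂ) → X →L[ℂ] X
  C : ℝ
  C_pos : 0 < C
  norm_bound : ∀ f, (‖Φ f‖₊ : ℝ≥0∞) ≤ ENNReal.ofReal C * mihlin α M f
  map_add : ∀ f g, mihlin α M f ≠ ⊤ → mihlin α M g ≠ ⊤ →
    Φ (fun t => f t + g t) = Φ f + Φ g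
  map_smul : ∀ (c : ℂ) f, mihlin α M f ≠ ⊤ → Φ (fun t => c * f t) = c • Φ f
  map_mul : ∀ f g, mihlin α M f ≠ ⊤ → mihlin α M g ≠ ⊤ →
    Φ (fun t => f t * g t) = Φ f * Φ g

/-- The Paley–Littlewood convergence property for a dyadic partition. -/
def PaleyLittlewoodProperty {α : ℝ} {M : ℕ} {X : Type*} [NormedAddCommGroup X]
    [NormedSpace ℂ X] (T : MihlinCalculus α M X) (P : DyadicPartition) : Prop :=
  ∀ x : X, Tendsto (fun N : ℕ => ∑ n ∈ Finset.Icc (-(N : ℤ)) (N : ℤ), T.Φ (P.fn n) x)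
    atTop (𝓝 x)

lemma iterDiff_eq_fwdDiff_iter (M : ℕ) (h : ℝ) (g : ℝ → ℂ) (x : ℝ) :
    iterDiff M h g x = (fwdDiff h)^[M] g x := by
  simp [iterDiff, fwdDiff_iter_eq_sum_shift, zsmul_eq_mul, nsmul_eq_mul]

lemma hasDerivAt_fwdDiff_iter {E : Type*} [NormedAddCommGroup E] [NormedSpace ℝ E] (M : ℕ) (h : ℝ)
    {f f' : ℝ → E} (hf : ∀ x, HasDerivAt f (f' x) x) (x : ℝ) :
    HasDerivAt ((fwdDiff h)^[M] f) ((fwdDiff h)^[M] f' x) x := by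
  induction M generalizing f f' with
  | zero => exact hf x
  | succ M ih => exact ih fun y => ((hf (y + h)).comp_add_const y h).sub (hf y)

lemma norm_fwdDiff_iter_le {E : Type*} [NormedAddCommGroup E] [NormedSpace ℝ E] (M : ℕ) {K : ℝ}
    {f : ℝ → E} (hf : ContDiff ℝ (⊤ : ℕ∞) f) (hK : ∀ x, ‖iteratedDeriv M f x‖ ≤ K) (h x : ℝ) :
    ‖(fwdDiff h)^[M] f x‖ ≤ K * |h| ^ M := by
  induction M generalizing f x with
  | zero => simpa using hK x
  | succ M ih =>
    rw [iteratedDeriv_succ'] at hK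
    have hd : ContDiff ℝ (⊤ : ℕ∞) (deriv f) := (contDiff_infty_iff_deriv.1 hf).2
    have hD : ∀ y, HasDerivAt f (deriv f y) y := fun y =>
      ((contDiff_infty_iff_deriv.1 hf).1 y).hasDerivAt
    rw [Function.iterate_succ_apply']
    have := (convex_univ (𝕜 := ℝ)).norm_image_sub_le_of_norm_hasDerivWithin_le
      (fun y _ => (hasDerivAt_fwdDiff_iter M h hD y).hasDerivWithinAt)
      (fun y _ => ih hd hK y) (Set.mem_univ x) (Set.mem_univ (x + h))
    calc ‖(fwdDiff h) ((fwdDiff h)^[M] f) x‖ ≤ K * |h| ^ M * ‖x + h - x‖ := this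
      _ = K * |h| ^ (M + 1) := by rw [add_sub_cancel_left, Real.norm_eq_abs]; ring

lemma exists_norm_iterDiff_le (M : ℕ) {g : ℝ → ℂ} (hg : ContDiff ℝ (⊤ : ℕ∞) g)
    (hc : HasCompactSupport g) : ∃ K, ∀ h x, ‖iterDiff M h g x‖ ≤ K * |h| ^ M := by
  obtain ⟨K, hK⟩ := (hc.iteratedFDeriv (𝕜 := ℝ) M).exists_bound_of_continuous
    (hg.continuous_iteratedFDeriv (by exact_mod_cast le_top))
  refine ⟨K, fun h x => ?_⟩
  rw [iterDiff_eq_fwdDiff_iter]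
  exact norm_fwdDiff_iter_le M hg
    (fun y => norm_iteratedFDeriv_eq_norm_iteratedDeriv (𝕜 := ℝ) (f := g) ▸ hK y) h x

lemma iterDiff_const_mul_comp_sub (M : ℕ) (h : ℝ) (c : ℂ) (g : ℝ → ℂ) (a x : ℝ) :
    iterDiff M h (fun s => c * g (s - a)) x = c * iterDiff M h g (x - a) := by
  simp only [iterDiff, Finset.mul_sum]
  refine Finset.sum_congr rfl fun j _ => ?_
  rw [show x + j * h - a = x - a + j * h by ring]
  ring

lemma integrableOn_abs_rpow {r : ℝ} (hr : -1 < r) :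
    IntegrableOn (fun h : ℝ => |h| ^ r) (Set.Ioo (-1) 1) := by
  have hI : IntervalIntegrable (fun h : ℝ => |h| ^ r) volume (-1) 1 := by
    refine intervalIntegrable_of_even (by simp) fun x hx => ?_
    refine (intervalIntegral.intervalIntegrable_rpow' (a := 0) (b := x) hr).congr ?_
    intro y hy
    rw [Set.uIoc_of_le hx.le] at hy
    simp [abs_of_pos hy.1]
  exact ((intervalIntegrable_iff_integrableOn_Ioc_of_le (by norm_num)).1 hI).mono_set
    Set.Ioo_subset_Ioc_self

lemma enorm_le_ofReal {E : Type*} [SeminormedAddGroup E] {z : E} {A : ℝ} (h : ‖z‖ ≤ A) :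
    (‖z‖₊ : ℝ≥0∞) ≤ ENNReal.ofReal A :=
  (ofReal_norm z).symm.trans_le (ENNReal.ofReal_le_ofReal h)

lemma besovI1_le {α : ℝ} {M : ℕ} (hM : α < M) {g : ℝ → ℂ} {A B : ℝ} (hB : 0 ≤ B)
    (hA : ∀ x, ‖g x‖ ≤ A) (hD : ∀ h x, ‖iterDiff M h g x‖ ≤ B * |h| ^ M) :
    besovI1 α M g ≤ ENNReal.ofReal (A + B * ∫ h in Set.Ioo (-1 : ℝ) 1, |h| ^ (M - α - 1)) := by
  have hA0 : 0 ≤ A := (norm_nonneg _).trans (hA 0)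
  have hint := integrableOn_abs_rpow (r := M - α - 1) (by linarith)
  have hnn : 0 ≤ ∫ h in Set.Ioo (-1 : ℝ) 1, |h| ^ (M - α - 1) :=
    integral_nonneg fun h => by positivity
  rw [ENNReal.ofReal_add hA0 (by positivity), ENNReal.ofReal_mul hB,
    ofReal_integral_eq_lintegral_ofReal hint (ae_of_all _ fun h => by positivity),
    ← lintegral_const_mul' _ _ ENNReal.ofReal_ne_top]
  refine add_le_add (iSup_le fun x => enorm_le_ofReal (hA x)) ?_
  have hae : ∀ᵐ h : ℝ ∂volume.restrict (Set.Ioo (-1 : ℝ) 1), h ≠ 0 :=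
    ae_restrict_of_ae (Measure.ae_ne volume 0)
  refine lintegral_mono_ae ?_
  filter_upwards [hae] with h h0
  calc _ ≤ ENNReal.ofReal (|h| ^ (-α - 1)) * ENNReal.ofReal (B * |h| ^ M) := by
        gcongr
        exact iSup_le fun x => enorm_le_ofReal (hD h x)
    _ = _ := by
        rw [← ENNReal.ofReal_mul (by positivity), ← ENNReal.ofReal_mul hB]
        congr 1
        rw [show (M : ℝ) - α - 1 = (-α - 1) + M by ring, Real.rpow_add (abs_pos.2 h0),
          Real.rpow_natCast]
        ring

lemma exists_mihlin_rpow_mul_dilation_le {α : ℝ} {M : ℕ} (hM : α < M) (θ : ℝ) {ψ : ℝ → ℝ}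
    (hψ : ContDiff ℝ (⊤ : ℕ∞) ψ) {a b : ℝ} (ha : 0 < a) (hsupp : ∀ t, ψ t ≠ 0 → t ∈ Set.Icc a b) :
    ∃ K : ℝ, 0 ≤ K ∧ ∀ n : ℤ,
      mihlin α M (fun t => ((t ^ θ : ℝ) : ℂ) * (ψ ((2 : ℝ) ^ (-n) * t) : ℂ)) ≤
        ENNReal.ofReal (K * (2 : ℝ) ^ ((n : ℝ) * θ)) := by
  set g : ℝ → ℂ := fun s => ((Real.exp (s * θ) * ψ (Real.exp s) : ℝ) : ℂ) with hg
  have hsm : ContDiff ℝ (⊤ : ℕ∞) g :=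
    Complex.ofRealCLM.contDiff.comp ((Real.contDiff_exp.comp (contDiff_id.mul contDiff_const)).mul
      (hψ.comp Real.contDiff_exp))
  have hc : HasCompactSupport g := by
    refine HasCompactSupport.intro (isCompact_Icc (a := Real.log a) (b := Real.log b)) fun s hs => ?_
    by_contra hne
    have hm := hsupp (Real.exp s) fun h0 => hne (by simp [hg, h0])
    have hb : 0 < b := (Real.exp_pos s).trans_le hm.2
    exact hs ⟨(Real.log_le_iff_le_exp ha).2 hm.1, (Real.le_log_iff_exp_le hb).2 hm.2⟩
  obtain ⟨A, hA⟩ := hc.exists_bound_of_continuous hsm.continuous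
  obtain ⟨B, hB⟩ := exists_norm_iterDiff_le M hsm hc
  have hA0 : 0 ≤ A := (norm_nonneg _).trans (hA 0)
  have hB0 : 0 ≤ B := by simpa using (norm_nonneg _).trans (hB 1 0)
  have hnn : 0 ≤ ∫ h in Set.Ioo (-1 : ℝ) 1, |h| ^ (M - α - 1) :=
    integral_nonneg fun h => by positivity
  refine ⟨A + B * ∫ h in Set.Ioo (-1 : ℝ) 1, |h| ^ (M - α - 1), by positivity, fun n => ?_⟩
  set c : ℝ := (2 : ℝ) ^ ((n : ℝ) * θ) with hcdef
  have hc0 : 0 ≤ c := by positivity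
  have hcn : ‖(c : ℂ)‖ = c := by rw [Complex.norm_real, Real.norm_of_nonneg hc0]
  have hfun : (fun s : ℝ => (((Real.exp s) ^ θ : ℝ) : ℂ) *
      (ψ ((2 : ℝ) ^ (-n) * Real.exp s) : ℂ)) =
      fun s => (c : ℂ) * g (s - n * Real.log 2) := by
    funext s
    have h1 : (2 : ℝ) ^ (-n) * Real.exp s = Real.exp (s - n * Real.log 2) := by
      rw [← Real.rpow_intCast, Real.rpow_def_of_pos two_pos, ← Real.exp_add]
      congr 1; push_cast; ring
    have h2 : Real.exp s ^ θ = c * Real.exp ((s - n * Real.log 2) * θ) := by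
      rw [hcdef, Real.rpow_def_of_pos two_pos, ← Real.exp_add, ← Real.exp_mul]
      congr 1; ring
    simp only [hg]
    rw [h1, h2]
    push_cast
    ring
  unfold mihlin
  rw [hfun]
  refine (besovI1_le hM (A := c * A) (B := c * B) (by positivity) (fun x => ?_)
    fun h x => ?_).trans_eq (by congr 1; ring)
  · rw [norm_mul, hcn]
    exact mul_le_mul_of_nonneg_left (hA _) hc0
  · rw [iterDiff_const_mul_comp_sub, norm_mul, hcn, mul_assoc]
    exact mul_le_mul_of_nonneg_left (hB _ _) hc0

lemma MihlinCalculus.norm_le {α : ℝ} {M : ℕ} {X : Type*} [NormedAddCommGroup X]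
    [NormedSpace ℂ X] (T : MihlinCalculus α M X) {f : ℝ → ℂ} {K : ℝ} (hK : 0 ≤ K)
    (h : mihlin α M f ≤ ENNReal.ofReal K) : ‖T.Φ f‖ ≤ T.C * K := by
  have hC := T.C_pos.le
  have h1 := (T.norm_bound f).trans (mul_le_mul_right h (ENNReal.ofReal T.C))
  rw [← ENNReal.ofReal_mul hC] at h1
  exact (ENNReal.ofReal_le_ofReal_iff (by positivity)).1
    ((ofReal_norm (T.Φ f)).trans_le h1)

namespace DyadicPartition

/-- The profile of the fattened partition `φ̇_{n-1} + φ̇_n + φ̇_{n+1}`. -/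
def fat (P : DyadicPartition) (t : ℝ) : ℝ :=
  P.φ (2 * t) + P.φ t + P.φ (t / 2)

lemma contDiff_fat (P : DyadicPartition) : ContDiff ℝ (⊤ : ℕ∞) P.fat :=
  ((P.smooth.comp (contDiff_const.mul contDiff_id)).add P.smooth).add
    (P.smooth.comp (contDiff_id.div_const 2))

lemma mem_Icc_of_fat_ne_zero (P : DyadicPartition) (t : ℝ) (ht : P.fat t ≠ 0) :
    t ∈ Set.Icc (1 / 4 : ℝ) 4 := by
  by_contra h
  refine ht ?_
  have key : ∀ u, ¬ (u ∈ Set.Icc (1 / 2 : ℝ) 2) → P.φ u = 0 := fun u hu => by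
    by_contra h0
    exact hu (P.suppSub u h0)
  simp only [Set.mem_Icc] at h key
  rw [fat, key, key, key, add_zero, add_zero] <;>
  · rintro ⟨h1, h2⟩
    exact h ⟨by linarith, by linarith⟩

lemma mem_Ioo_of_ne_zero (P : DyadicPartition) {t : ℝ} (ht : P.φ t ≠ 0) :
    t ∈ Set.Ioo (1 / 2 : ℝ) 2 := by
  rw [← interior_Icc]
  exact interior_maximal (fun u (hu : u ∈ {u | P.φ u ≠ 0}) => P.suppSub u hu)
    (isOpen_ne_fun P.smooth.continuous continuous_const) ht

lemma fat_eq_one (P : DyadicPartition) {t : ℝ} (ht : P.φ t ≠ 0) : P.fat t = 1 := by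
  obtain ⟨h1, h2⟩ := P.mem_Ioo_of_ne_zero ht
  have hz : ∀ n ∉ ({-1, 0, 1} : Finset ℤ), P.φ ((2 : ℝ) ^ (-n) * t) = 0 := by
    intro n hn
    by_contra h0
    obtain ⟨h3, h4⟩ := P.suppSub _ h0
    have hn' : 2 ≤ n ∨ n ≤ -2 := by
      simp only [Finset.mem_insert, Finset.mem_singleton] at hn
      omega
    rcases hn' with hn' | hn'
    · have : (2 : ℝ) ^ (-n) ≤ 2 ^ (-2 : ℤ) := zpow_le_zpow_right₀ (by norm_num) (by omega)
      norm_num only at this h3 h4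
      nlinarith
    · have : (2 : ℝ) ^ (2 : ℤ) ≤ 2 ^ (-n) := zpow_le_zpow_right₀ (by norm_num) (by omega)
      norm_num only at this h3 h4
      nlinarith
  have hs := (hasSum_sum_of_ne_finset_zero hz).unique (P.sum_one t (by linarith))
  rw [← hs]
  norm_num [fat]
  rw [show t / 2 = 1 / 2 * t by ring]
  ring

lemma fat_mul_self (P : DyadicPartition) (t : ℝ) : P.fat t * P.φ t = P.φ t := by
  by_cases h : P.φ t = 0
  · simp [h]
  · rw [P.fat_eq_one h, one_mul]

end DyadicPartition

/-- the continuous embeddings `Ḃ^θ_1 ⊂ Ẋ_θ ⊂ Ḃ^θ_∞`. -/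
theorem stmt_16 {X : Type*} [NormedAddCommGroup X] [NormedSpace ℂ X] [CompleteSpace X]
    (α θ : ℝ) (hα : 0 < α) (M : ℕ) (hM : α < (M : ℝ)) (P : DyadicPartition)
    (T : MihlinCalculus α M X) (hPL : PaleyLittlewoodProperty T P) :
    ∃ C : ℝ, 0 < C ∧
      (∀ (x y : X) (F : Finset ℤ), (∀ n : ℤ, n ∉ F → T.Φ (P.fn n) x = 0) →
        HasSum (fun n : ℤ => T.Φ (fun t => ((t ^ θ : ℝ) : ℂ) * P.fn n t) x) y →
        ‖y‖ ≤ C * ∑' n : ℤ, (2 : ℝ) ^ ((n : ℝ) * θ) * ‖T.Φ (P.fn n) x‖) ∧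
      (∀ x y : X,
        (∀ n : ℤ, T.Φ (P.fn n) x = T.Φ (fun t => ((t ^ (-θ) : ℝ) : ℂ) * P.fn n t) y) →
        ∀ n : ℤ, (2 : ℝ) ^ ((n : ℝ) * θ) * ‖T.Φ (P.fn n) x‖ ≤ C * ‖y‖) := by
  obtain ⟨K₁, hK₁, hfat⟩ := exists_mihlin_rpow_mul_dilation_le hM θ P.contDiff_fat
    (by norm_num : (0 : ℝ) < 1 / 4) P.mem_Icc_of_fat_ne_zero
  obtain ⟨K₂, hK₂, hneg⟩ := exists_mihlin_rpow_mul_dilation_le hM (-θ) P.smooth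
    (by norm_num : (0 : ℝ) < 1 / 2) P.suppSub
  obtain ⟨K₀, -, hzero⟩ := exists_mihlin_rpow_mul_dilation_le hM 0 P.smooth
    (by norm_num : (0 : ℝ) < 1 / 2) P.suppSub
  have hC := T.C_pos
  refine ⟨T.C * (K₁ + K₂ + 1), by positivity, fun x y F hF hy => ?_, fun x y hxy n => ?_⟩
  · have hfin : ∀ n, mihlin α M (P.fn n) ≠ ⊤ := fun n => by
      refine ne_top_of_le_ne_top ENNReal.ofReal_ne_top (le_of_eq_of_le ?_ (hzero n))
      congr 1
      funext t
      simp [DyadicPartition.fn]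
    have hmul : ∀ n : ℤ, T.Φ (fun t => ((t ^ θ : ℝ) : ℂ) * P.fn n t) x =
        T.Φ (fun t => ((t ^ θ : ℝ) : ℂ) * (P.fat ((2 : ℝ) ^ (-n) * t) : ℂ)) (T.Φ (P.fn n) x) := by
      intro n
      rw [← mul_apply_eq_comp, ← T.map_mul _ _
        (ne_top_of_le_ne_top ENNReal.ofReal_ne_top (hfat n)) (hfin n)]
      congr 2
      funext t
      simp only [DyadicPartition.fn]
      rw [mul_assoc, ← Complex.ofReal_mul (P.fat _), P.fat_mul_self]
    have hy' : ∑ n ∈ F, T.Φ (fun t => ((t ^ θ : ℝ) : ℂ) * P.fn n t) x = y :=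
      (hasSum_sum_of_ne_finset_zero fun n hn => by rw [hmul, hF n hn, map_zero]).unique hy
    rw [← hy', tsum_eq_sum (s := F) fun n hn => by rw [hF n hn, norm_zero, mul_zero],
      Finset.mul_sum]
    refine norm_sum_le_of_le _ fun n _ => ?_
    rw [hmul]
    calc _ ≤ T.C * (K₁ * (2 : ℝ) ^ ((n : ℝ) * θ)) * ‖T.Φ (P.fn n) x‖ :=
          ContinuousLinearMap.le_of_opNorm_le _ (T.norm_le (by positivity) (hfat n)) _
      _ = T.C * K₁ * ((2 : ℝ) ^ ((n : ℝ) * θ) * ‖T.Φ (P.fn n) x‖) := by ring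
      _ ≤ _ := by gcongr; linarith
  · rw [hxy n]
    calc _ ≤ (2 : ℝ) ^ ((n : ℝ) * θ) * (T.C * (K₂ * (2 : ℝ) ^ ((n : ℝ) * -θ)) * ‖y‖) := by
          gcongr
          exact ContinuousLinearMap.le_of_opNorm_le _ (T.norm_le (by positivity) (hneg n)) _
      _ = T.C * K₂ * ‖y‖ * ((2 : ℝ) ^ ((n : ℝ) * θ) * (2 : ℝ) ^ ((n : ℝ) * -θ)) := by ring
      _ = T.C * K₂ * ‖y‖ := by
          rw [← Real.rpow_add two_pos, mul_neg, add_neg_cancel, Real.rpow_zero, mul_one]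
      _ ≤ _ := by gcongr; linarith
end
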